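/- Let m ∈ ℕ, E ⊂ ℝᵐ, and let (r_k)_{k∈ℕ} be an unbounded increasing sequence of positive real numbers with limsup_{k→∞} r_{k+1}/r_k < +∞, such that each set E_k := E ∩ S(0, r_k) is σ_{r_k}-measurable and lim_{k→∞} σ_{r_k}(E_k)/r_k^{m-1} = 0. Then every subharmonic function v on all of ℝᵐ of finite order satisfies v(x) ≤ max{ sup_{B̄(0,r₁)} v, sup_{ℝᵐ \ E} v } for every x ∈ ℝᵐ. -/

import Mathlib

open MeasureTheory Metric Filter Set
open scoped ENNReal NNReal Topology

noncomputable section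

/-- `ℝᵐ` as the Euclidean space `EuclideanSpace ℝ (Fin m)`. -/
abbrev Em (m : ℕ) := EuclideanSpace ℝ (Fin m)

/-- The positive-part valued `ℝ≥0∞` of an extended real. -/
def EReal.toENNReal' (x : EReal) : ℝ≥0∞ :=
  if x = ⊤ then ⊤ else ENNReal.ofReal x.toReal

/-- Integral of an `EReal`-valued function: difference of the lower integrals of
the positive and the negative parts. -/
def eIntegral {α : Type*} [MeasurableSpace α] (μ : Measure α) (f : α → EReal) : EReal :=
  ((∫⁻ x, (f x).toENNReal' ∂μ : ℝ≥0∞) : EReal) - ((∫⁻ x, (-(f x)).toENNReal' ∂μ : ℝ≥0∞) : EReal)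

/-- Integrability of an `EReal`-valued function. -/
def EIntegrable {α : Type*} [MeasurableSpace α] (μ : Measure α) (f : α → EReal) : Prop :=
  Measurable f ∧ (∫⁻ x, (f x).toENNReal' ∂μ) < ⊤ ∧ (∫⁻ x, (-(f x)).toENNReal' ∂μ) < ⊤

/-- Surface (area) measure on the sphere of radius `t` centered at `x` in `ℝᵐ`:
the `(m-1)`-dimensional Hausdorff measure restricted to the sphere. -/
def sphereMeasure (m : ℕ) (x : Em m) (t : ℝ) : Measure (Em m) :=
  (μH[(m : ℝ) - 1]).restrict (Metric.sphere x t)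

/-- `s_{m-1}`: the surface area of the unit sphere in `ℝᵐ`. -/
def sphereArea (m : ℕ) : ℝ :=
  (μH[(m : ℝ) - 1] (Metric.sphere (0 : Em m) 1)).toReal

/-- `b_m`: the volume of the unit ball in `ℝᵐ`. -/
def ballVolume (m : ℕ) : ℝ :=
  (volume (Metric.closedBall (0 : Em m) 1)).toReal

/-- Mean of an `EReal`-valued function over the sphere `S(x,t) ⊂ ℝᵐ`. -/
def sMean (m : ℕ) (v : Em m → EReal) (x : Em m) (t : ℝ) : EReal :=
  ((1 / (sphereArea m * t ^ (m - 1)) : ℝ) : EReal) * eIntegral (sphereMeasure m x t) v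

/-- Mean of an `EReal`-valued function over the closed ball `B̄(x,t) ⊂ ℝᵐ`. -/
def bMean (m : ℕ) (v : Em m → EReal) (x : Em m) (t : ℝ) : EReal :=
  ((1 / (ballVolume m * t ^ m) : ℝ) : EReal) *
    eIntegral (volume.restrict (Metric.closedBall x t)) v

/-- A function is subharmonic on a set `U ⊆ ℝᵐ`: it is upper semicontinuous on `U`,
takes values in `[-∞, +∞)` on `U`, and satisfies the sub-mean inequality over every
sphere whose corresponding closed ball lies in `U`. -/
def SubharmonicOn (m : ℕ) (v : Em m → EReal) (U : Set (Em m)) : Prop :=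
  UpperSemicontinuousOn v U ∧ (∀ x ∈ U, v x ≠ ⊤) ∧
    ∀ x ∈ U, ∀ t : ℝ, 0 < t → Metric.closedBall x t ⊆ U → v x ≤ sMean m v x t

/-- The order (at `∞`) of an `EReal`-valued function on a normed space:
`limsup_{|x|→∞} ln(1 + v⁺(x)) / ln |x|`. -/
def ordE {V : Type*} [NormedAddCommGroup V] (v : V → EReal) : EReal :=
  Filter.limsup
    (fun x => ((Real.log (1 + max (v x).toReal 0) / Real.log ‖x‖ : ℝ) : EReal))
    (Bornology.cobounded V)

/-- The order (at `∞`) of a real-valued function on a normed space. -/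
def ordR {V : Type*} [NormedAddCommGroup V] (v : V → ℝ) : EReal :=
  Filter.limsup
    (fun x => ((Real.log (1 + max (v x) 0) / Real.log ‖x‖ : ℝ) : EReal))
    (Bornology.cobounded V)

section SphereMeasure

variable {n : ℕ}

open scoped Pointwise in
theorem hausdorffMeasure_sphere (x : Em (n + 1)) {t : ℝ} (ht : 0 < t) :
    μH[(n : ℝ)] (sphere x t) = ENNReal.ofReal (t ^ n) * μH[(n : ℝ)] (sphere (0 : Em (n + 1)) 1) := by
  have h1 : sphere x t = (IsometryEquiv.addRight x) '' (t • sphere (0 : Em (n + 1)) 1) := by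
    rw [_root_.smul_sphere _ _ zero_le_one]
    ext y
    simp [abs_of_pos ht, image_add_right, sub_eq_add_neg]
  rw [h1, IsometryEquiv.hausdorffMeasure_image,
    Measure.hausdorffMeasure_smul₀ (Nat.cast_nonneg n) ht.ne']
  rw [ENNReal.smul_def, smul_eq_mul, ENNReal.ofReal_pow ht.le]
  congr 1
  simp only [NNReal.rpow_natCast, ENNReal.coe_pow]
  rw [Real.nnnorm_of_nonneg ht.le, ENNReal.ofReal, Real.toNNReal_of_nonneg ht.le]

theorem lipschitzOnWith_normalize {F : Type*} [NormedAddCommGroup F] [NormedSpace ℝ F] :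
    LipschitzOnWith 2 (fun x : F => ‖x‖⁻¹ • x) {x | 1 ≤ ‖x‖} := by
  refine LipschitzOnWith.of_dist_le_mul fun x hx y hy => ?_
  simp only [mem_ofPred_eq] at hx hy
  have hx0 : 0 < ‖x‖ := by linarith
  have hy0 : 0 < ‖y‖ := by linarith
  have e : ‖x‖⁻¹ • x - ‖y‖⁻¹ • y = ‖x‖⁻¹ • (x - y) + (‖x‖⁻¹ * (‖y‖ - ‖x‖)) • (‖y‖⁻¹ • y) := by
    have : ‖x‖⁻¹ * (‖y‖ - ‖x‖) * ‖y‖⁻¹ = ‖x‖⁻¹ - ‖y‖⁻¹ := by field_simp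
    rw [smul_smul, this, sub_smul, smul_sub]
    abel
  have hxi : ‖x‖⁻¹ ≤ 1 := inv_le_one_of_one_le₀ hx
  have hn : ‖‖y‖⁻¹ • y‖ = 1 := by
    rw [norm_smul, norm_inv, norm_norm, inv_mul_cancel₀ hy0.ne']
  rw [dist_eq_norm, dist_eq_norm, e]
  refine (norm_add_le _ _).trans ?_
  rw [norm_smul, norm_smul, hn, norm_mul, norm_inv, norm_norm]
  have h2 : ‖‖y‖ - ‖x‖‖ ≤ ‖x - y‖ := by
    rw [norm_sub_rev x y]; exact abs_norm_sub_norm_le _ _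
  have h3 := norm_nonneg (x - y)
  have h4 := norm_nonneg (‖y‖ - ‖x‖)
  simp only [NNReal.coe_ofNat]
  nlinarith [mul_le_mul_of_nonneg_right hxi h3, mul_le_mul_of_nonneg_right hxi h4]

theorem hausdorffMeasure_unit_sphere_lt_top :
    μH[(n : ℝ)] (sphere (0 : Em (n + 1)) 1) < ⊤ := by
  let face : Fin (n + 1) → ℝ → (Fin n → ℝ) → Em (n + 1) :=
    fun i s y => WithLp.toLp 2 (i.insertNth s y)
  have hface : ∀ i s, LipschitzWith (NNReal.sqrt (Fintype.card (Fin (n + 1)))) (face i s) := by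
    intro i s
    have h1 := PiLp.lipschitzWith_toLp 2 (fun _ : Fin (n + 1) => ℝ)
    have h2 : LipschitzWith 1 (fun y : Fin n → ℝ => (i.insertNth s y : Fin (n + 1) → ℝ)) := by
      refine LipschitzWith.of_dist_le_mul fun y z => ?_
      rw [NNReal.coe_one, one_mul, dist_pi_le_iff dist_nonneg]
      intro j
      refine Fin.succAboveCases i ?_ (fun k => ?_) j
      · simp
      · simpa using dist_le_pi_dist y z k
    have := h1.comp h2
    convert this using 1
    · simp [NNReal.sqrt_eq_rpow]
    · rfl
  have hsub : sphere (0 : Em (n + 1)) 1 ⊆ ⋃ p : Fin (n + 1) × Bool,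
      (fun x : Em (n + 1) => ‖x‖⁻¹ • x) ''
        (face p.1 (if p.2 then 1 else -1) '' closedBall (0 : Fin n → ℝ) 1) := by
    intro x hx
    have hx1 : ‖x‖ = 1 := by simpa using hx
    obtain ⟨i, -, hi⟩ := Finset.exists_max_image Finset.univ (fun i => |x i|) Finset.univ_nonempty
    have hi0 : 0 < |x i| := by
      by_contra h
      have : x = 0 := by
        ext j
        have := (hi j (Finset.mem_univ j)).trans (not_lt.1 h)
        simpa using this
      simp [this] at hx1
    have hxi : x i ≠ 0 := abs_pos.1 hi0
    rw [mem_iUnion]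
    refine ⟨(i, decide (0 < x i)), |x i|⁻¹ • x, ⟨fun k => |x i|⁻¹ * x (i.succAbove k), ?_, ?_⟩, ?_⟩
    · rw [mem_closedBall_zero_iff, pi_norm_le_iff_of_nonneg zero_le_one]
      intro k
      rw [Real.norm_eq_abs, abs_mul, abs_inv, abs_abs, inv_mul_le_iff₀ hi0, mul_one]
      exact hi _ (Finset.mem_univ _)
    · ext j
      refine Fin.succAboveCases i ?_ (fun k => ?_) j
      · rcases lt_or_gt_of_ne hxi with h | h
        · simp [face, h.not_gt, abs_of_neg h, inv_mul_cancel₀ hxi]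
        · simp [face, h, abs_of_pos h, inv_mul_cancel₀ hxi]
      · simp [face]
    · simp [norm_smul, hx1, hi0.ne', smul_smul]
  refine (measure_mono hsub).trans_lt ((measure_iUnion_le _).trans_lt ?_)
  rw [tsum_fintype, ENNReal.sum_lt_top]
  rintro ⟨i, b⟩ -
  have hn : (0 : ℝ) ≤ n := Nat.cast_nonneg n
  have hge : face i (if b then 1 else -1) '' closedBall (0 : Fin n → ℝ) 1 ⊆ {x | 1 ≤ ‖x‖} := by
    rintro _ ⟨y, -, rfl⟩
    have := PiLp.norm_apply_le (face i (if b then 1 else -1) y) i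
    refine le_trans ?_ this
    cases b <;> simp [face]
  refine ((lipschitzOnWith_normalize.mono hge).hausdorffMeasure_image_le hn).trans_lt ?_
  refine ENNReal.mul_lt_top (by simp) ?_
  refine ((hface i _).hausdorffMeasure_image_le hn _).trans_lt ?_
  refine ENNReal.mul_lt_top (by simp [ENNReal.rpow_natCast]) ?_
  have h := hausdorffMeasure_pi_real (ι := Fin n)
  rw [Fintype.card_fin] at h
  rw [h]
  exact (isCompact_closedBall _ _).measure_lt_top

theorem hausdorffMeasure_unit_sphere_pos :
    0 < μH[(n : ℝ)] (sphere (0 : Em (n + 1)) 1) := by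
  let f : Em (n + 1) → (Fin n → ℝ) := fun x i => x i.succ
  have hf : LipschitzWith 1 f := by
    refine LipschitzWith.of_dist_le_mul fun y z => ?_
    rw [NNReal.coe_one, one_mul, dist_pi_le_iff dist_nonneg]
    intro j
    simpa [dist_eq_norm] using PiLp.norm_apply_le (y - z) j.succ
  have h1 := hf.hausdorffMeasure_image_le (Nat.cast_nonneg n) (sphere (0 : Em (n + 1)) 1)
  simp only [ENNReal.coe_one, ENNReal.one_rpow, one_mul] at h1
  refine lt_of_lt_of_le ?_ h1
  have h := hausdorffMeasure_pi_real (ι := Fin n)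
  rw [Fintype.card_fin] at h
  rw [h]
  have hopen : IsOpen {y : Fin n → ℝ | ∑ i, y i ^ 2 < 1} :=
    isOpen_lt (by fun_prop) continuous_const
  refine lt_of_lt_of_le (hopen.measure_pos _ ⟨0, by simp⟩) (measure_mono ?_)
  intro y hy
  simp only [mem_ofPred_eq] at hy
  refine ⟨WithLp.toLp 2 (Fin.cons (√(1 - ∑ i, y i ^ 2)) y), ?_, ?_⟩
  · rw [mem_sphere_zero_iff_norm, EuclideanSpace.norm_eq, Fin.sum_univ_succ]
    simp [Real.sq_sqrt (by linarith : (0 : ℝ) ≤ 1 - ∑ i, y i ^ 2)]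
  · ext i
    simp [f]

theorem sphereArea_pos : 0 < sphereArea (n + 1) := by
  have h : ((n + 1 : ℕ) : ℝ) - 1 = n := by push_cast; ring
  rw [sphereArea, h]
  exact ENNReal.toReal_pos hausdorffMeasure_unit_sphere_pos.ne'
    hausdorffMeasure_unit_sphere_lt_top.ne

theorem sphereMeasure_eq (x : Em (n + 1)) (t : ℝ) :
    sphereMeasure (n + 1) x t = (μH[(n : ℝ)]).restrict (sphere x t) := by
  have h : ((n + 1 : ℕ) : ℝ) - 1 = n := by push_cast; ring
  rw [sphereMeasure, h]

theorem sphereMeasure_real_univ (x : Em (n + 1)) {t : ℝ} (ht : 0 < t) :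
    (sphereMeasure (n + 1) x t).real univ = sphereArea (n + 1) * t ^ n := by
  have h : ((n + 1 : ℕ) : ℝ) - 1 = n := by push_cast; ring
  rw [sphereMeasure_eq, measureReal_restrict_apply_univ, measureReal_def,
    hausdorffMeasure_sphere x ht, ENNReal.toReal_mul, sphereArea, h,
    ENNReal.toReal_ofReal (by positivity), mul_comm]

theorem isFiniteMeasure_sphereMeasure (x : Em (n + 1)) {t : ℝ} (ht : 0 < t) :
    IsFiniteMeasure (sphereMeasure (n + 1) x t) := by
  rw [sphereMeasure_eq]
  refine ⟨?_⟩
  rw [Measure.restrict_apply_univ, hausdorffMeasure_sphere x ht]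
  exact ENNReal.mul_lt_top ENNReal.ofReal_lt_top hausdorffMeasure_unit_sphere_lt_top

end SphereMeasure


section SphericalMoments

variable {n : ℕ}

theorem ae_mem_sphere_sphereMeasure (x : Em (n + 1)) (t : ℝ) :
    ∀ᵐ y ∂sphereMeasure (n + 1) x t, y ∈ sphere x t :=
  ae_restrict_mem isClosed_sphere.measurableSet

theorem integrable_sphereMeasure_of_continuous {f : Em (n + 1) → ℝ} (hf : Continuous f)
    (x : Em (n + 1)) {t : ℝ} (ht : 0 < t) : Integrable f (sphereMeasure (n + 1) x t) := by
  have := isFiniteMeasure_sphereMeasure x ht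
  obtain ⟨C, hC⟩ := (isCompact_sphere x t).exists_bound_of_continuousOn hf.continuousOn
  refine Integrable.of_bound hf.aestronglyMeasurable C ?_
  filter_upwards [ae_mem_sphere_sphereMeasure x t] with y hy using hC y hy

theorem integral_sphere_comp_linearIsometryEquiv (x : Em (n + 1)) (t : ℝ)
    (L : Em (n + 1) ≃ₗᵢ[ℝ] Em (n + 1)) (f : Em (n + 1) → ℝ) :
    ∫ y, f (L (y - x)) ∂sphereMeasure (n + 1) x t =
      ∫ y, f (y - x) ∂sphereMeasure (n + 1) x t := by
  let e : Em (n + 1) ≃ᵢ Em (n + 1) :=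
    (IsometryEquiv.subRight x).trans (L.toIsometryEquiv.trans (IsometryEquiv.addRight x))
  have he : ∀ y, e y = L (y - x) + x := fun y => rfl
  have hpre : e ⁻¹' sphere x t = sphere x t := by
    ext y
    rw [mem_preimage, he, mem_sphere, mem_sphere, dist_eq_norm, add_sub_cancel_right, L.norm_map,
      dist_eq_norm]
  have hmp := (e.measurePreserving_hausdorffMeasure (n : ℝ)).restrict_preimage
    (isClosed_sphere (x := x) (ε := t)).measurableSet
  rw [hpre, ← sphereMeasure_eq] at hmp
  have := hmp.integral_comp e.toHomeomorph.measurableEmbedding (fun y => f (y - x))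
  simpa [he] using this

theorem integral_sphere_clm (x : Em (n + 1)) (t : ℝ) (φ : Em (n + 1) →L[ℝ] ℝ) :
    ∫ y, φ (y - x) ∂sphereMeasure (n + 1) x t = 0 := by
  have h := integral_sphere_comp_linearIsometryEquiv x t (LinearIsometryEquiv.neg ℝ) φ
  simp only [LinearIsometryEquiv.coe_neg, map_neg, integral_neg] at h
  linarith

theorem integral_sphere_coord_mul_coord (x : Em (n + 1)) (t : ℝ) {i j : Fin (n + 1)}
    (hij : i ≠ j) :
    ∫ y, (y - x) i * (y - x) j ∂sphereMeasure (n + 1) x t = 0 := by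
  have h := integral_sphere_comp_linearIsometryEquiv x t
    (LinearIsometryEquiv.piLpCongrRight 2
      (fun k : Fin (n + 1) => if k = i then LinearIsometryEquiv.neg ℝ
        else LinearIsometryEquiv.refl ℝ ℝ)) (fun h => h i * h j)
  simp only [LinearIsometryEquiv.piLpCongrRight_apply, if_true, hij.symm, if_false,
    LinearIsometryEquiv.coe_neg, LinearIsometryEquiv.coe_refl, id, neg_mul, integral_neg] at h
  linarith

theorem integral_sphere_coord_sq (x : Em (n + 1)) {t : ℝ} (ht : 0 < t) (i : Fin (n + 1)) :
    ∫ y, (y - x) i * (y - x) i ∂sphereMeasure (n + 1) x t =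
      t ^ 2 / (n + 1) * (sphereArea (n + 1) * t ^ n) := by
  have hsymm : ∀ j, ∫ y, (y - x) j * (y - x) j ∂sphereMeasure (n + 1) x t =
      ∫ y, (y - x) i * (y - x) i ∂sphereMeasure (n + 1) x t := by
    intro j
    have h := integral_sphere_comp_linearIsometryEquiv x t
      (LinearIsometryEquiv.piLpCongrLeft 2 ℝ ℝ (Equiv.swap i j)) (fun h => h i * h i)
    simpa [LinearIsometryEquiv.piLpCongrLeft_apply, Equiv.piCongrLeft'] using h
  have hsum : ∑ j, ∫ y, (y - x) j * (y - x) j ∂sphereMeasure (n + 1) x t =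
      t ^ 2 * (sphereArea (n + 1) * t ^ n) := by
    rw [← integral_finsetSum]
    · have : ∀ᵐ y ∂sphereMeasure (n + 1) x t, ∑ j, (y - x) j * (y - x) j = t ^ 2 := by
        filter_upwards [ae_mem_sphere_sphereMeasure x t] with y hy
        rw [mem_sphere, dist_eq_norm] at hy
        rw [← hy, EuclideanSpace.norm_sq_eq]
        simp [pow_two]
      rw [integral_congr_ae this, integral_const, sphereMeasure_real_univ x ht, smul_eq_mul,
        mul_comm]
    · intro j _
      exact integrable_sphereMeasure_of_continuous (by fun_prop) x ht
  simp only [hsymm, Finset.sum_const, Finset.card_univ, Fintype.card_fin, nsmul_eq_mul] at hsum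
  have : (0 : ℝ) < n + 1 := by positivity
  push_cast at hsum
  rw [div_mul_eq_mul_div, eq_div_iff this.ne']
  linarith

/-- The trace of a bilinear form in the standard basis. -/
def bilinTrace (B : Em (n + 1) →L[ℝ] Em (n + 1) →L[ℝ] ℝ) : ℝ :=
  ∑ i, B (EuclideanSpace.single i 1) (EuclideanSpace.single i 1)

theorem bilin_apply_eq_sum (B : Em (n + 1) →L[ℝ] Em (n + 1) →L[ℝ] ℝ) (h : Em (n + 1)) :
    B h h = ∑ i, ∑ j,
      B (EuclideanSpace.single i 1) (EuclideanSpace.single j 1) * (h i * h j) := by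
  have hh : h = ∑ i, h i • EuclideanSpace.single i (1 : ℝ) := by
    ext j
    simp [Finset.sum_apply, Pi.single_apply]
  conv_lhs => rw [hh]
  simp only [map_sum, map_smul, _root_.sum_apply, _root_.smul_apply,
    smul_eq_mul, Finset.mul_sum]
  rw [Finset.sum_comm]
  exact Finset.sum_congr rfl fun i _ => Finset.sum_congr rfl fun j _ => by ring

theorem integral_sphere_bilin (x : Em (n + 1)) {t : ℝ} (ht : 0 < t)
    (B : Em (n + 1) →L[ℝ] Em (n + 1) →L[ℝ] ℝ) :
    ∫ y, B (y - x) (y - x) ∂sphereMeasure (n + 1) x t =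
      t ^ 2 / (n + 1) * bilinTrace B * (sphereArea (n + 1) * t ^ n) := by
  have hint : ∀ i j : Fin (n + 1), Integrable (fun y : Em (n + 1) =>
      B (EuclideanSpace.single i 1) (EuclideanSpace.single j 1) * ((y - x) i * (y - x) j))
      (sphereMeasure (n + 1) x t) := fun i j =>
    integrable_sphereMeasure_of_continuous (by fun_prop) x ht
  simp only [bilin_apply_eq_sum B (_ - x)]
  rw [integral_finsetSum _ fun i _ => integrable_finsetSum _ fun j _ => hint i j]
  simp only [integral_finsetSum _ fun j _ => hint _ j, integral_const_mul]
  have : ∀ i j : Fin (n + 1), ∫ y, (y - x) i * (y - x) j ∂sphereMeasure (n + 1) x t =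
      if i = j then t ^ 2 / (n + 1) * (sphereArea (n + 1) * t ^ n) else 0 := by
    intro i j
    split_ifs with hij
    · subst hij; exact integral_sphere_coord_sq x ht i
    · exact integral_sphere_coord_mul_coord x t hij
  simp only [this, mul_ite, mul_zero, Finset.sum_ite_eq, Finset.mem_univ, if_true]
  rw [← Finset.sum_mul, bilinTrace]
  ring

end SphericalMoments

section TouchingQuadratics

variable {n : ℕ}

theorem eIntegral_le_integral {α : Type*} [MeasurableSpace α] {μ : Measure α} {v : α → EReal}
    {g : α → ℝ} (hg : Integrable g μ) (h : ∀ᵐ x ∂μ, v x ≤ (g x : EReal)) :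
    eIntegral μ v ≤ ((∫ x, g x ∂μ : ℝ) : EReal) := by
  have h1 : ∫⁻ x, (v x).toENNReal' ∂μ ≤ ∫⁻ x, ENNReal.ofReal (g x) ∂μ := by
    refine lintegral_mono_ae ?_
    filter_upwards [h] with x hx
    induction hv : v x with
    | bot => simp [EReal.toENNReal']
    | top => simp [hv] at hx
    | coe a =>
      rw [hv, EReal.coe_le_coe_iff] at hx
      simpa [EReal.toENNReal'] using ENNReal.ofReal_le_ofReal hx
  have h2 : ∫⁻ x, ENNReal.ofReal (-g x) ∂μ ≤ ∫⁻ x, (-(v x)).toENNReal' ∂μ := by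
    refine lintegral_mono_ae ?_
    filter_upwards [h] with x hx
    induction hv : v x with
    | bot => simp [EReal.toENNReal']
    | top => simp [hv] at hx
    | coe a =>
      rw [hv, EReal.coe_le_coe_iff] at hx
      rw [← EReal.coe_neg]
      simpa [EReal.toENNReal'] using ENNReal.ofReal_le_ofReal (neg_le_neg hx)
  have f1 : ∫⁻ x, ENNReal.ofReal (g x) ∂μ ≠ ⊤ := hg.lintegral_lt_top.ne
  have f2 : ∫⁻ x, ENNReal.ofReal (-g x) ∂μ ≠ ⊤ := hg.neg.lintegral_lt_top.ne
  rw [integral_eq_lintegral_pos_part_sub_lintegral_neg_part hg, EReal.coe_sub,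
    EReal.coe_ennreal_toReal f1, EReal.coe_ennreal_toReal f2]
  exact EReal.sub_le_sub (EReal.coe_ennreal_le_coe_ennreal_iff.2 h1)
    (EReal.coe_ennreal_le_coe_ennreal_iff.2 h2)

/-- A subharmonic function cannot be touched from above by a quadratic polynomial whose
quadratic part has negative trace. -/
theorem SubharmonicOn.trace_nonneg_of_le_quadratic {v : Em (n + 1) → EReal}
    (hv : SubharmonicOn (n + 1) v univ) {x : Em (n + 1)} {c : ℝ} (hx : v x = c)
    {t : ℝ} (ht : 0 < t) (φ : Em (n + 1) →L[ℝ] ℝ) (B : Em (n + 1) →L[ℝ] Em (n + 1) →L[ℝ] ℝ)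
    (hle : ∀ y ∈ sphere x t, v y ≤ ((c + φ (y - x) + B (y - x) (y - x) : ℝ) : EReal)) :
    0 ≤ bilinTrace B := by
  have hfin := isFiniteMeasure_sphereMeasure x ht
  have hi1 : Integrable (fun y => φ (y - x)) (sphereMeasure (n + 1) x t) :=
    integrable_sphereMeasure_of_continuous (by fun_prop) x ht
  have hi2 : Integrable (fun y => B (y - x) (y - x)) (sphereMeasure (n + 1) x t) :=
    integrable_sphereMeasure_of_continuous (by fun_prop) x ht
  have hi0 : Integrable (fun _ => c) (sphereMeasure (n + 1) x t) := integrable_const c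
  have hi01 : Integrable (fun y => c + φ (y - x)) (sphereMeasure (n + 1) x t) := hi0.add hi1
  have hI := eIntegral_le_integral (hi01.add hi2)
    ((ae_mem_sphere_sphereMeasure x t).mono fun y hy => hle y hy)
  have hval : ∫ y, (c + φ (y - x) + B (y - x) (y - x)) ∂sphereMeasure (n + 1) x t =
      (c + t ^ 2 / (n + 1) * bilinTrace B) * (sphereArea (n + 1) * t ^ n) := by
    rw [integral_add hi01 hi2, integral_add hi0 hi1, integral_const, integral_sphere_clm,
      integral_sphere_bilin x ht, sphereMeasure_real_univ x ht, smul_eq_mul]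
    ring
  have hA : 0 < sphereArea (n + 1) * t ^ n := mul_pos sphereArea_pos (pow_pos ht n)
  have hmean := hv.2.2 x (mem_univ x) t ht (subset_univ _)
  rw [hx, sMean, Nat.add_sub_cancel] at hmean
  have hc0 : (0 : EReal) ≤ ((1 / (sphereArea (n + 1) * t ^ n) : ℝ) : EReal) := by
    exact_mod_cast (by positivity : (0 : ℝ) ≤ 1 / (sphereArea (n + 1) * t ^ n))
  have h := hmean.trans (mul_le_mul_of_nonneg_left hI hc0)
  simp only [Pi.add_apply] at h
  rw [hval, ← EReal.coe_mul, EReal.coe_le_coe_iff] at h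
  have e : 1 / (sphereArea (n + 1) * t ^ n) *
      ((c + t ^ 2 / (n + 1) * bilinTrace B) * (sphereArea (n + 1) * t ^ n)) =
      c + t ^ 2 / (n + 1) * bilinTrace B := by
    rw [one_div, mul_comm, mul_assoc, mul_inv_cancel₀ hA.ne', mul_one]
  rw [e] at h
  have hpos : (0 : ℝ) < t ^ 2 / (n + 1) := by positivity
  exact nonneg_of_mul_nonneg_right (by linarith) hpos

end TouchingQuadratics


section TraceExpansion

open Asymptotics

variable {n : ℕ}

theorem bilinTrace_add (B C : Em (n + 1) →L[ℝ] Em (n + 1) →L[ℝ] ℝ) :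
    bilinTrace (B + C) = bilinTrace B + bilinTrace C := by
  simp [bilinTrace, Finset.sum_add_distrib]

theorem bilinTrace_smul (a : ℝ) (B : Em (n + 1) →L[ℝ] Em (n + 1) →L[ℝ] ℝ) :
    bilinTrace (a • B) = a * bilinTrace B := by
  simp [bilinTrace, Finset.mul_sum]

/-- The inner product as a bilinear (rather than sesquilinear) form. -/
def innerBilin : Em (n + 1) →L[ℝ] Em (n + 1) →L[ℝ] ℝ := innerSL ℝ

theorem innerBilin_apply (x y : Em (n + 1)) : innerBilin x y = inner ℝ x y := rfl

theorem bilinTrace_innerBilin : bilinTrace (innerBilin (n := n)) = n + 1 := by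
  simp [bilinTrace, innerBilin_apply]

theorem bilinTrace_smulRight (a b : Em (n + 1)) :
    bilinTrace ((innerBilin a).smulRight (innerBilin b)) = inner ℝ a b := by
  rw [PiLp.inner_apply]
  simp [bilinTrace, innerBilin_apply, EuclideanSpace.inner_single_right, mul_comm]

/-- `f` has a second order expansion at `x` whose quadratic part `h ↦ B h h` has trace `τ`. -/
def HasTraceExpansionAt (f : Em (n + 1) → ℝ) (x : Em (n + 1)) (τ : ℝ) : Prop :=
  ∃ (φ : Em (n + 1) →L[ℝ] ℝ) (B : Em (n + 1) →L[ℝ] Em (n + 1) →L[ℝ] ℝ), bilinTrace B = τ ∧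
    (fun h => f (x + h) - (f x + φ h + B h h)) =o[𝓝 0] fun h => ‖h‖ ^ 2

theorem HasTraceExpansionAt.add {f g : Em (n + 1) → ℝ} {x : Em (n + 1)} {τ τ' : ℝ}
    (hf : HasTraceExpansionAt f x τ) (hg : HasTraceExpansionAt g x τ') :
    HasTraceExpansionAt (fun y => f y + g y) x (τ + τ') := by
  obtain ⟨φ, B, hB, ho⟩ := hf
  obtain ⟨ψ, C, hC, ho'⟩ := hg
  refine ⟨φ + ψ, B + C, by rw [bilinTrace_add, hB, hC], (ho.add ho').congr_left fun h => ?_⟩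
  simp only [_root_.add_apply]
  ring

theorem HasTraceExpansionAt.const_mul {f : Em (n + 1) → ℝ} {x : Em (n + 1)} {τ : ℝ}
    (hf : HasTraceExpansionAt f x τ) (a : ℝ) :
    HasTraceExpansionAt (fun y => a * f y) x (a * τ) := by
  obtain ⟨φ, B, hB, ho⟩ := hf
  refine ⟨a • φ, a • B, by rw [bilinTrace_smul, hB], (ho.const_mul_left a).congr_left fun h => ?_⟩
  simp only [_root_.smul_apply, smul_eq_mul]
  ring

theorem hasTraceExpansionAt_const (a : ℝ) (x : Em (n + 1)) :
    HasTraceExpansionAt (fun _ => a) x 0 :=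
  ⟨0, 0, by simp [bilinTrace], by simp⟩

theorem HasTraceExpansionAt.sum {ι : Type*} (s : Finset ι) {f : ι → Em (n + 1) → ℝ}
    {x : Em (n + 1)} (hf : ∀ i ∈ s, HasTraceExpansionAt (f i) x 0) :
    HasTraceExpansionAt (fun y => ∑ i ∈ s, f i y) x 0 := by
  classical
  induction s using Finset.induction_on with
  | empty => simpa using hasTraceExpansionAt_const 0 x
  | insert i s hi ih =>
    simp only [Finset.sum_insert hi]
    simpa using (hf i (Finset.mem_insert_self i s)).add
      (ih fun j hj => hf j (Finset.mem_insert_of_mem hj))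

theorem hasTraceExpansionAt_norm_sq (x : Em (n + 1)) :
    HasTraceExpansionAt (fun y => ‖y‖ ^ 2) x (n + 1) := by
  refine ⟨(2 : ℝ) • innerBilin x, innerBilin, bilinTrace_innerBilin,
    (isLittleO_zero _ _).congr_left fun h => ?_⟩
  simp only [_root_.smul_apply, innerBilin_apply, smul_eq_mul, norm_add_sq_real,
    real_inner_self_eq_norm_sq]
  ring

theorem rpow_quadratic_expansion {s₀ : ℝ} (h0 : 0 < s₀) (a : ℝ) :
    (fun s : ℝ => s ^ a - (s₀ ^ a + a * s₀ ^ (a - 1) * (s - s₀) +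
      a * (a - 1) / 2 * s₀ ^ (a - 1 - 1) * (s - s₀) ^ 2)) =o[𝓝 s₀] fun s => (s - s₀) ^ 2 := by
  have hnhds : 𝓝[Ioi 0] s₀ = 𝓝 s₀ := (isOpen_Ioi.nhdsWithin_eq h0)
  have h1 : (fun s : ℝ => a * s ^ (a - 1) - a * s₀ ^ (a - 1) -
      (s - s₀) * (a * (a - 1) * s₀ ^ (a - 1 - 1))) =o[𝓝 s₀] fun s => (s - s₀) ^ 1 := by
    have := ((Real.hasDerivAt_rpow_const (p := a - 1) (Or.inl h0.ne')).const_mul a).isLittleO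
    simpa [mul_assoc] using this
  have h2 := Convex.isLittleO_pow_succ_real (n := 1) (convex_Ioi (0 : ℝ)) (x₀ := s₀) h0
    (f := fun s => s ^ a - (s₀ ^ a + a * s₀ ^ (a - 1) * (s - s₀) +
      a * (a - 1) / 2 * s₀ ^ (a - 1 - 1) * (s - s₀) ^ 2))
    (f' := fun s => a * s ^ (a - 1) - a * s₀ ^ (a - 1) -
      (s - s₀) * (a * (a - 1) * s₀ ^ (a - 1 - 1))) (fun s hs => ?_) (by rwa [hnhds])
  · rw [hnhds] at h2
    simpa using h2
  · have e1 := Real.hasDerivAt_rpow_const (p := a) (Or.inl (ne_of_gt hs))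
    have e2 := (hasDerivAt_id s).sub_const s₀
    have e3 := e1.sub ((((e2.const_mul (a * s₀ ^ (a - 1))).const_add (s₀ ^ a))).add
      ((e2.pow 2).const_mul (a * (a - 1) / 2 * s₀ ^ (a - 1 - 1))))
    refine (HasDerivAt.congr_deriv (f' :=
      a * s ^ (a - 1) - (a * s₀ ^ (a - 1) * 1 +
        a * (a - 1) / 2 * s₀ ^ (a - 1 - 1) * (2 * (s - s₀) ^ 1 * 1))) (f := fun s => s ^ a - (s₀ ^ a + a * s₀ ^ (a - 1) * (s - s₀) +
      a * (a - 1) / 2 * s₀ ^ (a - 1 - 1) * (s - s₀) ^ 2)) ?_ ?_).hasDerivWithinAt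
    · convert! e3 using 1
    · ring

/-- The (unnormalised) Poisson kernel of the ball centered at `0` with pole `p`. -/
def poissonKernelWithPole (p x : Em (n + 1)) : ℝ :=
  (‖p‖ ^ 2 - ‖x‖ ^ 2) * (‖x - p‖ ^ (n + 1))⁻¹

theorem hasTraceExpansionAt_poissonKernelWithPole {p x : Em (n + 1)} (hx : x ≠ p) :
    HasTraceExpansionAt (poissonKernelWithPole p) x 0 := by
  set z := x - p with hz
  have hz0 : 0 < ‖z‖ := norm_pos_iff.2 (sub_ne_zero.2 hx)
  set s₀ := ‖z‖ ^ 2 with hs₀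
  have hs0 : 0 < s₀ := by positivity
  set a : ℝ := -((n + 1 : ℝ) / 2) with ha
  set N := ‖p‖ ^ 2 - ‖x‖ ^ 2 with hN
  set c₀ := s₀ ^ a with hc₀
  set c₁ := a * s₀ ^ (a - 1) with hc₁
  set c₂ := a * (a - 1) / 2 * s₀ ^ (a - 1 - 1) with hc₂
  have hpow : ∀ w : Em (n + 1), (‖w‖ ^ (n + 1))⁻¹ = (‖w‖ ^ 2) ^ a := by
    intro w
    rw [ha, Real.rpow_neg (by positivity), ← Real.rpow_natCast, ← Real.rpow_natCast,
      ← Real.rpow_mul (norm_nonneg _)]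
    congr 2
    push_cast
    ring
  have hsq : ∀ h : Em (n + 1), ‖z + h‖ ^ 2 - s₀ = 2 * inner ℝ z h + ‖h‖ ^ 2 := by
    intro h
    rw [norm_add_sq_real]
    ring
  have hinner : ∀ w : Em (n + 1), (fun h => inner ℝ w h) =O[𝓝 0] fun h : Em (n + 1) => ‖h‖ := by
    intro w
    refine IsBigO.of_bound ‖w‖ (Eventually.of_forall fun h => ?_)
    simpa using abs_real_inner_le_norm w h
  have htend : ∀ w : Em (n + 1), Tendsto (fun h : Em (n + 1) => inner ℝ w h) (𝓝 0) (𝓝 0) := by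
    intro w
    have : Continuous fun h : Em (n + 1) => inner ℝ w h := by fun_prop
    simpa using this.tendsto 0
  have hlin : (fun h : Em (n + 1) => ‖z + h‖ ^ 2 - s₀) =O[𝓝 0] fun h => ‖h‖ := by
    simp only [hsq]
    refine ((hinner z).const_mul_left 2).add ?_
    refine (IsLittleO.isBigO ?_)
    have := (isLittleO_pow_pow (𝕜 := ℝ) one_lt_two).comp_tendsto
      (tendsto_norm_zero (E := Em (n + 1)))
    simpa only [Function.comp_def, pow_one] using this
  have hE : (fun h : Em (n + 1) => (‖z + h‖ ^ 2) ^ a - (c₀ + c₁ * (2 * inner ℝ z h + ‖h‖ ^ 2) +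
      c₂ * (2 * inner ℝ z h + ‖h‖ ^ 2) ^ 2)) =o[𝓝 0] fun h => ‖h‖ ^ 2 := by
    have ht : Tendsto (fun h : Em (n + 1) => ‖z + h‖ ^ 2) (𝓝 0) (𝓝 s₀) := by
      have : Continuous fun h : Em (n + 1) => ‖z + h‖ ^ 2 := by fun_prop
      simpa using this.tendsto 0
    have h := (rpow_quadratic_expansion hs0 a).comp_tendsto ht
    simp only [Function.comp_def, hsq] at h
    simp only [hsq] at hlin
    exact h.trans_isBigO (hlin.pow 2)
  refine ⟨(2 * N * c₁) • innerBilin z + (-2 * c₀) • innerBilin x,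
    (N * c₁ - c₀) • innerBilin + ((4 * N * c₂) • (innerBilin z).smulRight (innerBilin z) +
      (-4 * c₁) • (innerBilin x).smulRight (innerBilin z)), ?_, ?_⟩
  · rw [bilinTrace_add, bilinTrace_add, bilinTrace_smul, bilinTrace_smul, bilinTrace_smul,
      bilinTrace_innerBilin, bilinTrace_smulRight, bilinTrace_smulRight, real_inner_self_eq_norm_sq,
      ← hs₀, hc₁, hc₂, Real.rpow_sub_one hs0.ne' (a - 1),
      Real.rpow_sub_one hs0.ne' a, ← hc₀]
    have e1 : inner ℝ x z = ‖x‖ ^ 2 - inner ℝ x p := by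
      rw [hz, inner_sub_right, real_inner_self_eq_norm_sq]
    have e2 : s₀ = ‖x‖ ^ 2 - 2 * inner ℝ x p + ‖p‖ ^ 2 := by
      rw [hs₀, hz, norm_sub_sq_real]
    have e3 : N = s₀ - 2 * inner ℝ x z := by rw [hN, e1, e2]; ring
    rw [e3, ha]
    field_simp
    ring
  · have hNb : (fun h : Em (n + 1) => N - 2 * inner ℝ x h - ‖h‖ ^ 2) =O[𝓝 0]
        fun _ => (1 : ℝ) := by
      have : Continuous fun h : Em (n + 1) => N - 2 * inner ℝ x h - ‖h‖ ^ 2 := by fun_prop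
      exact this.continuousAt.isBigO_one ℝ
    have hA : (fun h : Em (n + 1) => N * c₂ * (4 * inner ℝ z h + ‖h‖ ^ 2) - 2 * inner ℝ x h * c₁
        - 2 * inner ℝ x h * c₂ * (4 * inner ℝ z h + ‖h‖ ^ 2) - c₁ * (2 * inner ℝ z h + ‖h‖ ^ 2)
        - c₂ * (2 * inner ℝ z h + ‖h‖ ^ 2) ^ 2) =o[𝓝 0] fun _ => (1 : ℝ) := by
      rw [isLittleO_one_iff]
      have : Continuous fun h : Em (n + 1) => N * c₂ * (4 * inner ℝ z h + ‖h‖ ^ 2)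
        - 2 * inner ℝ x h * c₁
        - 2 * inner ℝ x h * c₂ * (4 * inner ℝ z h + ‖h‖ ^ 2) - c₁ * (2 * inner ℝ z h + ‖h‖ ^ 2)
        - c₂ * (2 * inner ℝ z h + ‖h‖ ^ 2) ^ 2 := by fun_prop
      simpa using this.tendsto 0
    have hB : (fun h : Em (n + 1) => -8 * c₂ * inner ℝ x h) =o[𝓝 0] fun _ => (1 : ℝ) := by
      rw [isLittleO_one_iff]
      simpa using (htend x).const_mul (-8 * c₂)
    have r1 := hNb.mul_isLittleO hE
    have r2 := hA.mul_isBigO (isBigO_refl (fun h : Em (n + 1) => ‖h‖ ^ 2) (𝓝 0))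
    have r3 := hB.mul_isBigO ((hinner z).pow 2)
    simp only [one_mul] at r1 r2 r3
    refine ((r1.add r2).add r3).congr_left fun h => ?_
    simp only [poissonKernelWithPole, _root_.add_apply, _root_.smul_apply, innerBilin_apply,
      ContinuousLinearMap.smulRight_apply, smul_eq_mul, hpow, real_inner_self_eq_norm_sq,
      add_sub_right_comm x h p, ← hz, ← hN, ← hs₀, ← hc₀]
    rw [norm_add_sq_real x h, hN]
    ring

end TraceExpansion


section MaximumPrinciple

variable {n : ℕ}

theorem SubharmonicOn.le_of_le_on_sphere {v : Em (n + 1) → EReal}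
    (hv : SubharmonicOn (n + 1) v univ) {R : ℝ} {w : Em (n + 1) → ℝ}
    (hwc : ContinuousOn w (closedBall 0 R))
    (hw : ∀ x ∈ ball (0 : Em (n + 1)) R, ∃ τ < 0, HasTraceExpansionAt w x τ)
    (hle : ∀ x ∈ sphere (0 : Em (n + 1)) R, v x ≤ w x) :
    ∀ x ∈ closedBall (0 : Em (n + 1)) R, v x ≤ w x := by
  intro x₁ hx₁
  by_contra! hlt
  have husc : UpperSemicontinuousOn (fun y => v y + ((-w y : ℝ) : EReal)) (closedBall 0 R) := by
    refine (hv.1.mono (subset_univ _)).add' ?_ fun x _ => ?_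
    · exact (continuous_coe_real_ereal.comp_continuousOn hwc.neg).upperSemicontinuousOn
    · exact EReal.continuousAt_add (Or.inr (EReal.coe_ne_bot _)) (Or.inr (EReal.coe_ne_top _))
  obtain ⟨x₀, hx₀, hmax⟩ := husc.exists_isMaxOn ⟨x₁, hx₁⟩ (isCompact_closedBall _ _)
  have hpos : ∀ x, (w x : EReal) < v x ↔ 0 < v x + ((-w x : ℝ) : EReal) := by
    intro x
    induction hvx : v x with
    | bot => simp
    | top => exact absurd hvx (hv.2.1 x (mem_univ x))
    | coe a =>
      rw [← EReal.coe_add, EReal.coe_lt_coe_iff, ← EReal.coe_zero, EReal.coe_lt_coe_iff]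
      constructor <;> intro h <;> linarith
  have h0 : (w x₀ : EReal) < v x₀ := (hpos x₀).2 (((hpos x₁).1 hlt).trans_le (hmax hx₁))
  have hx₀b : x₀ ∈ ball (0 : Em (n + 1)) R := by
    rcases (mem_closedBall.1 hx₀).lt_or_eq with h | h
    · exact h
    · exact absurd h0 (hle x₀ h).not_gt
  obtain ⟨c, hc⟩ : ∃ c : ℝ, v x₀ = c := by
    induction hvx : v x₀ with
    | bot => simp [hvx] at h0
    | top => exact absurd hvx (hv.2.1 x₀ (mem_univ x₀))
    | coe a => exact ⟨a, rfl⟩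
  have hvle : ∀ y ∈ closedBall (0 : Em (n + 1)) R, v y ≤ ((w y + (c - w x₀) : ℝ) : EReal) := by
    intro y hy
    have h := hmax hy
    simp only [mem_ofPred_eq, hc] at h
    induction hvy : v y with
    | bot => simp
    | top => exact absurd hvy (hv.2.1 y (mem_univ y))
    | coe a =>
      rw [hvy, ← EReal.coe_add, ← EReal.coe_add, EReal.coe_le_coe_iff] at h
      rw [EReal.coe_le_coe_iff]
      linarith
  obtain ⟨τ, hτ, φ, B, hB, ho⟩ := hw x₀ hx₀b
  set ε : ℝ := -τ / (2 * (n + 1)) with hε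
  have hn : (0 : ℝ) < n + 1 := by positivity
  have hε0 : 0 < ε := div_pos (by linarith) (by positivity)
  have hball : ∀ᶠ h in 𝓝 (0 : Em (n + 1)), x₀ + h ∈ ball (0 : Em (n + 1)) R := by
    have : Tendsto (fun h => x₀ + h) (𝓝 0) (𝓝 x₀) := by
      simpa using (continuous_const.add continuous_id).tendsto (0 : Em (n + 1)) (f := fun h => x₀ + h)
    exact this (isOpen_ball.mem_nhds hx₀b)
  obtain ⟨t, ht, hsub⟩ := Metric.eventually_nhds_iff_ball.1 (hball.and (ho.def hε0))
  have htrace := hv.trace_nonneg_of_le_quadratic hc (half_pos ht) φ (B + ε • innerBilin) ?_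
  · rw [bilinTrace_add, bilinTrace_smul, bilinTrace_innerBilin, hB, hε] at htrace
    have : -τ / (2 * (n + 1)) * (n + 1) = -τ / 2 := by field_simp
    linarith
  · intro y hy
    rw [mem_sphere, dist_eq_norm] at hy
    obtain ⟨h1, h2⟩ := hsub (y - x₀) (by rw [mem_ball_zero_iff, hy]; linarith)
    rw [add_sub_cancel] at h1 h2
    refine (hvle y (ball_subset_closedBall h1)).trans (EReal.coe_le_coe_iff.2 ?_)
    rw [Real.norm_eq_abs, Real.norm_eq_abs, abs_of_nonneg (sq_nonneg ‖y - x₀‖)] at h2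
    have := le_abs_self (w y - (w x₀ + φ (y - x₀) + B (y - x₀) (y - x₀)))
    simp only [_root_.add_apply, _root_.smul_apply, innerBilin_apply, smul_eq_mul,
      real_inner_self_eq_norm_sq]
    linarith

end MaximumPrinciple

section SmallSets

theorem IsCompact.exists_finset_ball_cover_of_hausdorffMeasure_lt {X : Type*} [Nonempty X]
    [MetricSpace X] [MeasurableSpace X] [BorelSpace X] {F : Set X} (hF : IsCompact F) {n : ℕ} {R δ : ℝ}
    (hR : 0 < R) (hδ : 0 < δ) (hlt : μH[(n : ℝ)] F < ENNReal.ofReal δ) :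
    ∃ (s : Finset ℕ) (y : ℕ → X) (ρ : ℕ → ℝ), (∀ i ∈ s, y i ∈ F ∧ 0 < ρ i ∧ ρ i ≤ R) ∧
      F ⊆ ⋃ i ∈ s, ball (y i) (ρ i) ∧ ∑ i ∈ s, ρ i ^ n ≤ 2 * δ := by
  rw [Measure.hausdorffMeasure_apply] at hlt
  have hlt' := (le_iSup₂ (f := fun (r : ℝ≥0∞) (_ : 0 < r) =>
    ⨅ (t : ℕ → Set X) (_ : F ⊆ ⋃ n, t n) (_ : ∀ n, ediam (t n) ≤ r),
      ∑' i, ⨆ _ : (t i).Nonempty, ediam (t i) ^ (n : ℝ)) (ENNReal.ofReal (R / 2))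
      (ENNReal.ofReal_pos.2 (half_pos hR))).trans_lt hlt
  simp only [iInf_lt_iff] at hlt'
  obtain ⟨t, hFt, hdiam, hsum⟩ := hlt'
  have hfin : ∀ i, ediam (t i) ≠ ⊤ := fun i =>
    ((hdiam i).trans_lt ENNReal.ofReal_lt_top).ne
  have hdR : ∀ i, Metric.diam (t i) < R := fun i => by
    have := ENNReal.toReal_le_of_le_ofReal (half_pos hR).le (hdiam i)
    exact lt_of_le_of_lt this (half_lt_self hR)
  have hρ : ∀ i, ∃ ρ, Metric.diam (t i) < ρ ∧ ρ < R ∧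
      ρ ^ n < Metric.diam (t i) ^ n + δ / 2 / 2 ^ i := by
    intro i
    have h1 : ∀ᶠ ρ in 𝓝[>] Metric.diam (t i), ρ ^ n < Metric.diam (t i) ^ n + δ / 2 / 2 ^ i :=
      ((continuous_pow n).continuousAt.eventually_lt continuousAt_const
        (by simp; positivity)).filter_mono nhdsWithin_le_nhds
    have h2 : ∀ᶠ ρ in 𝓝[>] Metric.diam (t i), ρ < R :=
      (eventually_lt_nhds (hdR i)).filter_mono nhdsWithin_le_nhds
    obtain ⟨ρ, h3, h4, h5⟩ := (eventually_mem_nhdsWithin.and (h2.and h1)).exists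
    exact ⟨ρ, h3, h4, h5⟩
  choose ρ hρ1 hρ2 hρ3 using hρ
  rcases F.eq_empty_or_nonempty with rfl | ⟨x₀, hx₀⟩
  · exact ⟨∅, fun _ => Classical.arbitrary X, ρ, by simp, by simp, by simp; positivity⟩
  have hy : ∀ i, ∃ y, y ∈ F ∧ ((t i ∩ F).Nonempty → y ∈ t i) := by
    intro i
    by_cases h : (t i ∩ F).Nonempty
    · exact ⟨h.some, h.some_mem.2, fun _ => h.some_mem.1⟩
    · exact ⟨x₀, hx₀, fun h' => absurd h' h⟩
  choose y hyF hyt using hy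
  obtain ⟨s, hsI, hsfin, hsc⟩ := hF.elim_finite_subcover_image
    (b := {i | (t i ∩ F).Nonempty}) (c := fun i => ball (y i) (ρ i)) (fun i _ => isOpen_ball)
    (fun x hx => by
      obtain ⟨i, hi⟩ := mem_iUnion.1 (hFt hx)
      have hne : (t i ∩ F).Nonempty := ⟨x, hi, hx⟩
      refine mem_iUnion₂.2 ⟨i, hne, ?_⟩
      exact (Metric.dist_le_diam_of_mem' (hfin i) hi (hyt i hne)).trans_lt (hρ1 i))
  lift s to Finset ℕ using hsfin
  refine ⟨s, y, ρ, fun i _ => ⟨hyF i, Metric.diam_nonneg.trans_lt (hρ1 i), (hρ2 i).le⟩,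
    by simpa using hsc, ?_⟩
  have hd : ∑ i ∈ s, Metric.diam (t i) ^ n ≤ δ := by
    rw [← ENNReal.ofReal_le_ofReal_iff hδ.le, ENNReal.ofReal_sum_of_nonneg
      fun i _ => pow_nonneg Metric.diam_nonneg n]
    refine le_trans ?_ hsum.le
    refine le_trans (Finset.sum_le_sum fun i hi => ?_) (ENNReal.sum_le_tsum s)
    have hne : (t i).Nonempty := (hsI hi).mono inter_subset_left
    rw [iSup_pos hne, ENNReal.rpow_natCast, ENNReal.ofReal_pow Metric.diam_nonneg, Metric.diam,
      ENNReal.ofReal_toReal (hfin i)]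
  have hg : ∑ i ∈ s, δ / 2 / 2 ^ i ≤ δ := by
    refine ((summable_geometric_two' δ).sum_le_tsum s fun i _ => by positivity).trans_eq ?_
    exact tsum_geometric_two' δ
  calc ∑ i ∈ s, ρ i ^ n ≤ ∑ i ∈ s, (Metric.diam (t i) ^ n + δ / 2 / 2 ^ i) :=
        Finset.sum_le_sum fun i _ => (hρ3 i).le
    _ ≤ 2 * δ := by rw [Finset.sum_add_distrib]; linarith

end SmallSets

section PoissonKernelBounds

variable {n : ℕ}

theorem poissonKernelWithPole_nonneg {p x : Em (n + 1)} (h : ‖x‖ ≤ ‖p‖) :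
    0 ≤ poissonKernelWithPole p x := by
  refine mul_nonneg (sub_nonneg.2 ?_) (by positivity)
  gcongr

theorem norm_one_add_div_smul {y : Em (n + 1)} {R ρ : ℝ} (hR : 0 < R) (hρ : 0 < ρ) (hy : ‖y‖ = R) :
    ‖(1 + ρ / R) • y‖ = R + ρ := by
  rw [norm_smul, hy, Real.norm_of_nonneg (by positivity)]
  field_simp

theorem one_le_mul_poissonKernelWithPole {x y : Em (n + 1)} {R ρ : ℝ} (hR : 0 < R) (hρ : 0 < ρ)
    (hy : ‖y‖ = R) (hx : ‖x‖ = R) (hxy : x ∈ ball y ρ) :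
    1 ≤ 2 ^ n * ρ ^ n / R * poissonKernelWithPole ((1 + ρ / R) • y) x := by
  have hp := norm_one_add_div_smul hR hρ hy
  set p := (1 + ρ / R) • y with hpdef
  have hxp0 : 0 < ‖x - p‖ := by
    rw [norm_pos_iff, sub_ne_zero]
    rintro h
    rw [← h, hx] at hp
    linarith
  have hxp : ‖x - p‖ ≤ 2 * ρ := by
    have h1 : x - p = (x - y) - (ρ / R) • y := by rw [hpdef]; module
    have h2 : ‖(ρ / R) • y‖ = ρ := by
      rw [norm_smul, hy, Real.norm_of_nonneg (by positivity)]
      field_simp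
    have h3 := norm_sub_le (x - y) ((ρ / R) • y)
    rw [mem_ball, dist_eq_norm] at hxy
    rw [h1]
    linarith
  have hpow : ‖x - p‖ ^ (n + 1) ≤ (2 * ρ) ^ (n + 1) := by gcongr
  rw [poissonKernelWithPole, hp, hx, ← mul_assoc, ← div_eq_mul_inv, le_div_iff₀ (by positivity),
    one_mul]
  refine hpow.trans ?_
  have : 2 ^ n * ρ ^ n / R * ((R + ρ) ^ 2 - R ^ 2) = (2 * ρ) ^ (n + 1) + 2 ^ n * ρ ^ n / R * ρ ^ 2 := by
    field_simp
    ring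
  rw [this]
  have : 0 ≤ 2 ^ n * ρ ^ n / R * ρ ^ 2 := by positivity
  linarith

theorem mul_poissonKernelWithPole_le {x y : Em (n + 1)} {R ρ : ℝ} (hR : 0 < R) (hρ : 0 < ρ)
    (hρR : ρ ≤ R) (hy : ‖y‖ = R) (hx : ‖x‖ ≤ R / 2) :
    2 ^ n * ρ ^ n / R * poissonKernelWithPole ((1 + ρ / R) • y) x ≤
      2 ^ (2 * n + 3) * (ρ ^ n / R ^ n) := by
  have hp := norm_one_add_div_smul hR hρ hy
  set p := (1 + ρ / R) • y with hpdef
  have hxp : R / 2 ≤ ‖x - p‖ := by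
    have := norm_sub_norm_le p x
    rw [norm_sub_rev] at this
    linarith
  have hnum : ‖p‖ ^ 2 - ‖x‖ ^ 2 ≤ 4 * R ^ 2 := by
    rw [hp]
    nlinarith [sq_nonneg ‖x‖]
  have hinv : (‖x - p‖ ^ (n + 1))⁻¹ ≤ ((R / 2) ^ (n + 1))⁻¹ := by gcongr
  calc 2 ^ n * ρ ^ n / R * poissonKernelWithPole p x
      ≤ 2 ^ n * ρ ^ n / R * (4 * R ^ 2 * ((R / 2) ^ (n + 1))⁻¹) := by
        rw [poissonKernelWithPole]
        gcongr
    _ = 2 ^ (2 * n + 3) * (ρ ^ n / R ^ n) := by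
        rw [div_pow]
        field_simp
        ring

end PoissonKernelBounds


section PhragmenLindelof

variable {n : ℕ}

theorem continuousOn_poissonKernelWithPole (p : Em (n + 1)) :
    ContinuousOn (poissonKernelWithPole p) {p}ᶜ := by
  refine ContinuousOn.mul (by fun_prop) (ContinuousOn.inv₀ (by fun_prop) fun x hx => ?_)
  exact pow_ne_zero _ (norm_ne_zero_iff.2 (sub_ne_zero.2 hx))

/-- If the set where `v` exceeds `M` on the sphere of radius `R` has small surface measure, then
the excess of `v` over `M` is small on the ball of radius `R / 2`. -/
theorem SubharmonicOn.le_of_hausdorffMeasure_superlevel_lt {v : Em (n + 1) → EReal}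
    (hv : SubharmonicOn (n + 1) v univ) {R M A δ : ℝ} (hR : 0 < R) (hA : 0 ≤ A) (hδ : 0 < δ)
    (hb : ∀ x ∈ closedBall (0 : Em (n + 1)) R, v x ≤ ((M + A : ℝ) : EReal))
    (hsmall : μH[(n : ℝ)] {x ∈ sphere (0 : Em (n + 1)) R | (M : EReal) < v x} <
      ENNReal.ofReal (δ * R ^ n)) {x : Em (n + 1)} (hx : ‖x‖ ≤ R / 2) :
    v x ≤ ((M + 2 ^ (2 * n + 4) * δ * A : ℝ) : EReal) := by
  suffices h : ∀ η : ℝ, 0 < η →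
      v x ≤ ((M + 2 ^ (2 * n + 4) * δ * A + 2 * η : ℝ) : EReal) by
    refine EReal.le_of_forall_lt_iff_le.1 fun z hz => ?_
    rw [EReal.coe_lt_coe_iff] at hz
    refine (h ((z - (M + 2 ^ (2 * n + 4) * δ * A)) / 2) (by linarith)).trans ?_
    rw [EReal.coe_le_coe_iff]
    linarith
  intro η hη
  set F : Set (Em (n + 1)) := {x ∈ sphere (0 : Em (n + 1)) R | ((M + η : ℝ) : EReal) ≤ v x} with hF
  have hFc : IsCompact F := by
    have hcl : IsClosed {x | ((M + η : ℝ) : EReal) ≤ v x} :=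
      (upperSemicontinuousOn_univ_iff.1 hv.1).isClosed_preimage _
    exact (isCompact_sphere 0 R).inter_right hcl
  have hFlt : μH[(n : ℝ)] F < ENNReal.ofReal (δ * R ^ n) := by
    have hsub : F ⊆ {x ∈ sphere (0 : Em (n + 1)) R | (M : EReal) < v x} := fun y hy =>
      ⟨hy.1, (EReal.coe_lt_coe_iff.2 (lt_add_of_pos_right M hη)).trans_le hy.2⟩
    exact (measure_mono hsub).trans_lt hsmall
  obtain ⟨s, y, ρ, hs, hcover, hsum⟩ :=
    hFc.exists_finset_ball_cover_of_hausdorffMeasure_lt hR (by positivity) hFlt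
  have hyR : ∀ i ∈ s, ‖y i‖ = R := fun i hi => by simpa using (hs i hi).1.1
  let p : ℕ → Em (n + 1) := fun i => (1 + ρ i / R) • y i
  have hp : ∀ i ∈ s, ‖p i‖ = R + ρ i := fun i hi =>
    norm_one_add_div_smul hR (hs i hi).2.1 (hyR i hi)
  have hpx : ∀ i ∈ s, ∀ z ∈ closedBall (0 : Em (n + 1)) R, z ≠ p i := by
    rintro i hi z hz rfl
    rw [mem_closedBall_zero_iff, hp i hi] at hz
    linarith [(hs i hi).2.1]
  let P : ℕ → Em (n + 1) → ℝ := fun i z =>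
    2 ^ n * ρ i ^ n / R * poissonKernelWithPole (p i) z
  have hP0 : ∀ i ∈ s, ∀ z ∈ closedBall (0 : Em (n + 1)) R, 0 ≤ P i z := by
    intro i hi z hz
    have := (hs i hi).2.1
    refine mul_nonneg (by positivity) (poissonKernelWithPole_nonneg ?_)
    rw [hp i hi]
    rw [mem_closedBall_zero_iff] at hz
    linarith
  let w : Em (n + 1) → ℝ := fun z =>
    (M + 2 * η) + (A * ∑ i ∈ s, P i z + (-(η / R ^ 2)) * ‖z‖ ^ 2)
  have hsphere : ∀ z ∈ sphere (0 : Em (n + 1)) R, v z ≤ w z := by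
    intro z hz
    have hzR : ‖z‖ = R := by simpa using hz
    have hzc := sphere_subset_closedBall hz
    have hw : w z = M + η + A * ∑ i ∈ s, P i z := by
      simp only [w, hzR]
      field_simp
      ring
    rw [hw]
    by_cases hzF : z ∈ F
    · obtain ⟨i, hi, hzi⟩ := mem_iUnion₂.1 (hcover hzF)
      refine (hb z hzc).trans (EReal.coe_le_coe_iff.2 ?_)
      have h1 : 1 ≤ P i z :=
        one_le_mul_poissonKernelWithPole hR (hs i hi).2.1 (hyR i hi) hzR hzi
      have h2 : P i z ≤ ∑ i ∈ s, P i z :=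
        Finset.single_le_sum (f := fun i => P i z) (fun j hj => hP0 j hj z hzc) hi
      nlinarith
    · have h1 : v z < ((M + η : ℝ) : EReal) := not_le.1 fun h => hzF ⟨hz, h⟩
      refine h1.le.trans (EReal.coe_le_coe_iff.2 ?_)
      have := mul_nonneg hA (Finset.sum_nonneg fun i hi => hP0 i hi z hzc)
      linarith
  have hwc : ContinuousOn w (closedBall 0 R) := by
    refine continuousOn_const.add (ContinuousOn.add ?_ (by fun_prop))
    refine continuousOn_const.mul (continuousOn_finsetSum s fun i hi => ?_)
    exact continuousOn_const.mul
      ((continuousOn_poissonKernelWithPole (p i)).mono fun z hz => hpx i hi z hz)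
  have hwt : ∀ z ∈ ball (0 : Em (n + 1)) R, ∃ τ < 0, HasTraceExpansionAt w z τ := by
    intro z hz
    have h1 : HasTraceExpansionAt (fun z => ∑ i ∈ s, P i z) z 0 :=
      HasTraceExpansionAt.sum s fun i hi => by
        simpa using (hasTraceExpansionAt_poissonKernelWithPole
          (hpx i hi z (ball_subset_closedBall hz))).const_mul (2 ^ n * ρ i ^ n / R)
    refine ⟨_, ?_, (hasTraceExpansionAt_const (M + 2 * η) z).add ((h1.const_mul A).add
      ((hasTraceExpansionAt_norm_sq z).const_mul (-(η / R ^ 2))))⟩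
    have : 0 < η / R ^ 2 * (n + 1) := by positivity
    linarith
  have hxR : x ∈ closedBall (0 : Em (n + 1)) R := by
    rw [mem_closedBall_zero_iff]
    linarith
  refine (hv.le_of_le_on_sphere hwc hwt hsphere x hxR).trans (EReal.coe_le_coe_iff.2 ?_)
  have h1 : ∑ i ∈ s, P i x ≤ ∑ i ∈ s, 2 ^ (2 * n + 3) * (ρ i ^ n / R ^ n) :=
    Finset.sum_le_sum fun i hi =>
      mul_poissonKernelWithPole_le hR (hs i hi).2.1 (hs i hi).2.2 (hyR i hi) hx
  have h2 : ∑ i ∈ s, 2 ^ (2 * n + 3) * (ρ i ^ n / R ^ n) ≤ 2 ^ (2 * n + 4) * δ := by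
    rw [← Finset.mul_sum, ← Finset.sum_div]
    have h3 : (∑ i ∈ s, ρ i ^ n) / R ^ n ≤ 2 * δ := by
      rw [div_le_iff₀ (by positivity)]
      linarith
    calc 2 ^ (2 * n + 3) * ((∑ i ∈ s, ρ i ^ n) / R ^ n) ≤ 2 ^ (2 * n + 3) * (2 * δ) := by gcongr
      _ = 2 ^ (2 * n + 4) * δ := by ring
  have h3 : A * ∑ i ∈ s, P i x ≤ A * (2 ^ (2 * n + 4) * δ) :=
    mul_le_mul_of_nonneg_left (h1.trans h2) hA
  have h4 : 0 ≤ η / R ^ 2 * ‖x‖ ^ 2 := by positivity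
  simp only [w]
  linarith

theorem exists_index_between {r : ℕ → ℝ} (hmono : Monotone r) (hunb : Tendsto r atTop atTop)
    {K : ℝ} {k₀ : ℕ} (hpos : ∀ k, 0 < r k) (hK : ∀ k ≥ k₀, r (k + 1) ≤ K * r k) {k : ℕ}
    (hk : k₀ ≤ k) : ∃ j ≥ k, 2 * r k ≤ r j ∧ r j ≤ 2 * K * r k := by
  have hex : ∃ j, 2 * r k ≤ r j := (hunb.eventually_ge_atTop (2 * r k)).exists
  classical
  set j := Nat.find hex with hj
  have hj1 : 2 * r k ≤ r j := Nat.find_spec hex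
  have hkj : k < j := by
    by_contra! h
    linarith [hmono h, hpos k]
  obtain ⟨i, hi⟩ : ∃ i, j = i + 1 := ⟨j - 1, by omega⟩
  have hi2 : r i < 2 * r k := not_le.1 (Nat.find_min hex (by omega))
  have hiK := hK i (by omega)
  have hK0 : 0 ≤ K := by
    by_contra! h
    nlinarith [hpos (i + 1), hpos i]
  refine ⟨j, hkj.le, hj1, ?_⟩
  rw [hi]
  nlinarith

/-- A function of finite order which is bounded above on balls has polynomial growth. -/
theorem exists_pow_bound_of_ordE_lt_top {v : Em (n + 1) → EReal}
    (hv : SubharmonicOn (n + 1) v univ) (hord : ordE v < ⊤) (M : ℝ) :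
    ∃ (p : ℕ) (D : ℝ), 0 ≤ D ∧ ∀ R : ℝ, 1 ≤ R → ∀ x ∈ closedBall (0 : Em (n + 1)) R,
      v x ≤ ((M + D * R ^ p : ℝ) : EReal) := by
  obtain ⟨q, hq, -⟩ := EReal.lt_iff_exists_real_btwn.1 hord
  have hev := eventually_lt_of_limsup_lt hq
  obtain ⟨p, hp⟩ := exists_nat_ge q
  have hev1 : ∀ᶠ x : Em (n + 1) in Bornology.cobounded _, 1 < ‖x‖ :=
    tendsto_norm_cobounded_atTop.eventually_gt_atTop 1
  obtain ⟨R₀, hR₀⟩ := (Metric.hasBasis_cobounded_compl_closedBall (0 : Em (n + 1))).eventually_iff.1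
    (hev.and hev1)
  obtain ⟨x₀, -, hmax⟩ := (hv.1.mono (subset_univ (closedBall 0 (max R₀ 0)))).exists_isMaxOn
    ⟨0, by simp⟩ (isCompact_closedBall _ _)
  have hreal : ∀ x, v x ≤ ((v x).toReal : EReal) := fun x =>
    EReal.le_coe_toReal (hv.2.1 x (mem_univ x))
  set D := |(v x₀).toReal| + 1 + |M| with hD
  have hD0 : 0 ≤ D := by positivity
  refine ⟨p, D, hD0, fun R hR x hx => ?_⟩
  have hRp : 1 ≤ R ^ p := one_le_pow₀ hR
  have hM : -M ≤ |M| := neg_le_abs M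
  by_cases hxR : x ∈ closedBall (0 : Em (n + 1)) (max R₀ 0)
  · refine ((hmax hxR).trans (hreal x₀)).trans (EReal.coe_le_coe_iff.2 ?_)
    have : D ≤ D * R ^ p := le_mul_of_one_le_right hD0 hRp
    have := le_abs_self (v x₀).toReal
    linarith
  · obtain ⟨h1, h2⟩ := hR₀.2 (show x ∈ (closedBall (0 : Em (n + 1)) R₀)ᶜ from fun h =>
      hxR (closedBall_subset_closedBall (le_max_left _ _) h))
    refine (hreal x).trans (EReal.coe_le_coe_iff.2 ?_)
    rw [EReal.coe_lt_coe_iff] at h1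
    have hlog : 0 < Real.log ‖x‖ := Real.log_pos h2
    rw [div_lt_iff₀ hlog] at h1
    have hle : Real.log (1 + max (v x).toReal 0) ≤ Real.log (‖x‖ ^ p) := by
      rw [Real.log_pow]
      nlinarith
    have hpos : 0 < 1 + max (v x).toReal 0 := by positivity
    have hle' := (Real.log_le_log_iff hpos (by positivity)).1 hle
    have hxle : ‖x‖ ^ p ≤ R ^ p := by
      gcongr
      simpa using hx
    have := le_max_left (v x).toReal 0
    have : (1 + |M|) * R ^ p ≤ D * R ^ p := by
      gcongr
      rw [hD]
      linarith [abs_nonneg (v x₀).toReal]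
    have : |M| ≤ |M| * R ^ p := le_mul_of_one_le_right (abs_nonneg M) hRp
    linarith

/-- A subharmonic function of polynomial growth which exceeds `M` only on small portions of
a commensurable sequence of spheres does not exceed `M` at all. -/
theorem SubharmonicOn.le_of_small_superlevel_on_spheres {v : Em (n + 1) → EReal}
    (hv : SubharmonicOn (n + 1) v univ) (hord : ordE v < ⊤) {r : ℕ → ℝ} (hrpos : ∀ k, 0 < r k)
    (hrmono : Monotone r) (hrunb : Tendsto r atTop atTop) {K : ℝ}
    (hK : ∀ᶠ k in atTop, r (k + 1) ≤ K * r k) {M : ℝ}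
    (hsmall : ∀ δ : ℝ, 0 < δ → ∀ᶠ k in atTop,
      μH[(n : ℝ)] {x ∈ sphere (0 : Em (n + 1)) (r k) | (M : EReal) < v x} <
        ENNReal.ofReal (δ * r k ^ n)) (x : Em (n + 1)) : v x ≤ M := by
  obtain ⟨p, D, hD, hgrowth⟩ := exists_pow_bound_of_ordE_lt_top hv hord M
  set L := max (2 * K) 1 with hL
  have hL1 : 1 ≤ L := le_max_right _ _
  set δ : ℝ := (2 ^ (2 * n + 4) * L ^ p * 2)⁻¹ with hδ
  have hδ0 : 0 < δ := by positivity
  obtain ⟨k₀, hk₀⟩ := eventually_atTop.1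
    (hK.and ((hsmall δ hδ0).and ((hrunb.eventually_ge_atTop 1).and
      (hrunb.eventually_ge_atTop ‖x‖))))
  have hiter : ∀ N : ℕ, ∀ k ≥ k₀, ∀ y ∈ closedBall (0 : Em (n + 1)) (r k),
      v y ≤ ((M + D * (1 / 2) ^ N * r k ^ p : ℝ) : EReal) := by
    intro N
    induction N with
    | zero =>
      intro k hk y hy
      simpa using hgrowth (r k) (hk₀ k hk).2.2.1 y hy
    | succ N ih =>
      intro k hk y hy
      obtain ⟨j, hjk, hj1, hj2⟩ :=
        exists_index_between hrmono hrunb hrpos (fun k hk => (hk₀ k hk).1) hk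
      have hj0 := hrpos j
      have hk0 := hrpos k
      have hy' : ‖y‖ ≤ r j / 2 := by
        rw [mem_closedBall_zero_iff] at hy
        linarith
      refine (hv.le_of_hausdorffMeasure_superlevel_lt hj0 (by positivity) hδ0
        (ih j (hk.le.trans hjk)) (hk₀ j (hk.le.trans hjk)).2.1 hy').trans
        (EReal.coe_le_coe_iff.2 ?_)
      have hjL : r j ≤ L * r k :=
        hj2.trans (mul_le_mul_of_nonneg_right (le_max_left _ _) hk0.le)
      have hjp : r j ^ p ≤ L ^ p * r k ^ p := by
        rw [← mul_pow]
        gcongr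
      calc M + 2 ^ (2 * n + 4) * δ * (D * (1 / 2) ^ N * r j ^ p)
          ≤ M + 2 ^ (2 * n + 4) * δ * (D * (1 / 2) ^ N * (L ^ p * r k ^ p)) := by gcongr
        _ = M + D * (1 / 2) ^ (N + 1) * r k ^ p := by
          rw [hδ]
          field_simp
          ring
  have hxk : x ∈ closedBall (0 : Em (n + 1)) (r k₀) := by
    rw [mem_closedBall_zero_iff]
    exact (hk₀ k₀ le_rfl).2.2.2
  have hlim : Tendsto (fun N : ℕ => ((M + D * (1 / 2) ^ N * r k₀ ^ p : ℝ) : EReal)) atTop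
      (𝓝 (M : EReal)) := by
    refine (continuous_coe_real_ereal.tendsto M).comp ?_
    have h := tendsto_pow_atTop_nhds_zero_of_lt_one (r := (1 / 2 : ℝ)) (by norm_num) (by norm_num)
    simpa using ((h.const_mul D).mul_const (r k₀ ^ p)).const_add M
  exact ge_of_tendsto' hlim fun N => hiter N k₀ le_rfl x hxk

end PhragmenLindelof


/-- A subharmonic function of finite order on all of `ℝᵐ` is pointwise bounded by the
maximum of its sup over the closed ball `B̄(0, r₁)` and its sup over `ℝᵐ \ E`, where `E`
is asymptotically small on a commensurable sequence of spheres.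
The sequence `(r k)_{k ∈ ℕ}` is indexed from `0`, so `r 0` plays the role of `r₁`. -/
theorem subharmonic_pointwise_bound (m : ℕ) (hm : 1 ≤ m)
    (E : Set (Em m)) (r : ℕ → ℝ)
    (hrpos : ∀ k, 0 < r k) (hrmono : Monotone r)
    (hrunb : Tendsto r atTop atTop)
    (hratio : Filter.limsup (fun k => ((r (k + 1) / r k : ℝ) : EReal)) atTop < ⊤)
    (hmeas : ∀ k, MeasurableSet (E ∩ Metric.sphere (0 : Em m) (r k)))
    (hsmall : Tendsto
      (fun k => μH[(m : ℝ) - 1] (E ∩ Metric.sphere (0 : Em m) (r k)) /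
        ENNReal.ofReal ((r k) ^ (m - 1))) atTop (𝓝 0))
    (v : Em m → EReal)
    (hsub : SubharmonicOn m v Set.univ)
    (hord : ordE v < ⊤) :
    ∀ x : Em m, v x ≤
      max (sSup (v '' Metric.closedBall (0 : Em m) (r 0))) (sSup (v '' Eᶜ)) := by
  obtain ⟨n, rfl⟩ : ∃ n, m = n + 1 := ⟨m - 1, by omega⟩
  intro x
  have hcast : ((n + 1 : ℕ) : ℝ) - 1 = n := by push_cast; ring
  rw [hcast, Nat.add_sub_cancel] at hsmall
  obtain ⟨K, hK, -⟩ := EReal.lt_iff_exists_real_btwn.1 hratio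
  have hK' : ∀ᶠ k in atTop, r (k + 1) ≤ K * r k := by
    filter_upwards [eventually_lt_of_limsup_lt hK] with k hk
    rw [EReal.coe_lt_coe_iff, div_lt_iff₀ (hrpos k)] at hk
    exact hk.le
  refine EReal.le_of_forall_lt_iff_le.1 fun M hM => ?_
  refine hsub.le_of_small_superlevel_on_spheres hord hrpos hrmono hrunb hK' (fun δ hδ => ?_) x
  filter_upwards [hsmall.eventually_lt_const (ENNReal.ofReal_pos.2 hδ)] with k hk
  have hrk := pow_pos (hrpos k) n
  rw [ENNReal.div_lt_iff (Or.inl (ENNReal.ofReal_pos.2 hrk).ne') (Or.inl ENNReal.ofReal_ne_top),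
    ← ENNReal.ofReal_mul hδ.le] at hk
  have hsubE : {x ∈ sphere (0 : Em (n + 1)) (r k) | (M : EReal) < v x} ⊆
      E ∩ sphere 0 (r k) := fun y hy => ⟨by_contra fun hyE => (hy.2.trans_le
    ((le_sSup (mem_image_of_mem v hyE)).trans (le_max_right _ _))).not_gt hM, hy.1⟩
  exact (measure_mono hsubE).trans_lt hk
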